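/- Let β ∈ (1,2] and let q ∈ [(1+√5)/2, β) be such that 1 has a unique q-expansion. Then the sequence 0α(q) (a 0 followed by the quasi-greedy q-expansion of 1) belongs to Ũ_β; in particular, π_β(0α(q)) ∈ U_β. -/

import Mathlib

/-- Strict lexicographic order on sequences: `a ≺ b`. -/
def lexLt (a b : ℕ → ℕ) : Prop := ∃ n, (∀ i < n, a i = b i) ∧ a n < b n

/-- Lexicographic order `a ≼ b`. -/
def lexLe (a b : ℕ → ℕ) : Prop := lexLt a b ∨ a = b

/-- A sequence does not end with `0^∞`. -/
def notEndZero (γ : ℕ → ℕ) : Prop := ∀ n, ∃ m, n ≤ m ∧ γ m ≠ 0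

/-- `γ` is the quasi-greedy β-expansion of 1. -/
def isQuasiGreedy (β : ℝ) (γ : ℕ → ℕ) : Prop :=
  (∀ i, γ i ≤ 1) ∧ notEndZero γ ∧ (∑' i : ℕ, (γ i : ℝ) / β ^ (i + 1)) = 1 ∧
  ∀ δ : ℕ → ℕ, (∀ i, δ i ≤ 1) → notEndZero δ →
    (∑' i : ℕ, (δ i : ℝ) / β ^ (i + 1)) = 1 → lexLe δ γ

/-- `ε` is a β-expansion of `x`. -/
def isExpansion (β x : ℝ) (ε : ℕ → ℕ) : Prop :=
  (∀ i, ε i ≤ 1) ∧ x = ∑' i : ℕ, (ε i : ℝ) / β ^ (i + 1)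

/-- `ε` is a univoque sequence for base β. -/
def isUnivoqueSeq (β : ℝ) (ε : ℕ → ℕ) : Prop :=
  (∀ i, ε i ≤ 1) ∧ ∀ δ : ℕ → ℕ, (∀ i, δ i ≤ 1) →
    (∑' i : ℕ, (δ i : ℝ) / β ^ (i + 1)) = (∑' i : ℕ, (ε i : ℝ) / β ^ (i + 1)) →
    δ = ε

/-- The sequence `0γ`: a `0` followed by `γ`. -/
def prepend0 (γ : ℕ → ℕ) : ℕ → ℕ
  | 0 => 0
  | k + 1 => γ k

/-- Value of a digit sequence. -/
noncomputable def expVal (b : ℝ) (s : ℕ → ℕ) : ℝ := ∑' i : ℕ, (s i : ℝ) / b ^ (i + 1)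

lemma expVal_hasSum_one (b : ℝ) (hb : 1 < b) :
    HasSum (fun i : ℕ => (1 : ℝ) / b ^ (i + 1)) (1 / (b - 1)) := by
  have h0 : b ≠ 0 := by positivity
  have h1 : b - 1 ≠ 0 := by linarith
  have h := (hasSum_geometric_of_lt_one (r := b⁻¹) (by positivity)
    (inv_lt_one_of_one_lt₀ hb)).mul_left b⁻¹
  have e : b⁻¹ * (1 - b⁻¹)⁻¹ = 1 / (b - 1) := by
    rw [← mul_inv, mul_sub, mul_inv_cancel₀ h0, mul_one, one_div]
  rw [e] at h
  refine h.congr_fun ?_ |> fun x => x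
  intro i
  rw [pow_succ, one_div, mul_inv, inv_pow, mul_comm]

lemma expVal_summable (b : ℝ) (hb : 1 < b) (s : ℕ → ℕ) (hs : ∀ i, s i ≤ 1) :
    Summable (fun i : ℕ => (s i : ℝ) / b ^ (i + 1)) := by
  refine Summable.of_nonneg_of_le (fun i => by positivity) (fun i => ?_)
    (expVal_hasSum_one b hb).summable
  have : (s i : ℝ) ≤ 1 := by exact_mod_cast hs i
  gcongr

lemma expVal_nonneg (b : ℝ) (hb : 1 < b) (s : ℕ → ℕ) : 0 ≤ expVal b s :=
  tsum_nonneg (fun i => by positivity)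

lemma expVal_split (b : ℝ) (hb : 1 < b) (s : ℕ → ℕ) (hs : ∀ i, s i ≤ 1) :
    b * expVal b s = s 0 + expVal b (fun i => s (i + 1)) := by
  have h0 : b ≠ 0 := by positivity
  unfold expVal
  rw [(expVal_summable b hb s hs).tsum_eq_zero_add, mul_add, ← tsum_mul_left]
  congr 1
  · simp; field_simp
  · refine tsum_congr fun i => ?_
    rw [pow_succ b (i + 1)]
    field_simp

lemma expVal_conj (b : ℝ) (hb : 1 < b) (s : ℕ → ℕ) (hs : ∀ i, s i ≤ 1) :
    expVal b s + expVal b (fun i => 1 - s i) = 1 / (b - 1) := by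
  unfold expVal
  rw [← (expVal_summable b hb s hs).tsum_add
    (expVal_summable b hb (fun i => 1 - s i) (fun i => by omega)),
    ← (expVal_hasSum_one b hb).tsum_eq]
  refine tsum_congr fun i => ?_
  rw [Nat.cast_sub (hs i)]
  push_cast
  ring

lemma expVal_mono (q b : ℝ) (hq : 1 < q) (hb : q ≤ b) (s : ℕ → ℕ) (hs : ∀ i, s i ≤ 1) :
    expVal b s ≤ expVal q s := by
  refine (expVal_summable b (by linarith) s hs).tsum_le_tsum (fun i => ?_)
    (expVal_summable q hq s hs)
  gcongr

lemma expVal_strict (q b : ℝ) (hq : 1 < q) (hb : q < b) (s : ℕ → ℕ) (hs : ∀ i, s i ≤ 1)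
    (m : ℕ) (hm : s m ≠ 0) : expVal b s < expVal q s := by
  refine Summable.tsum_lt_tsum (i := m) (fun i => ?_) ?_
    (expVal_summable b (by linarith) s hs) (expVal_summable q hq s hs)
  · gcongr
  · have : (0 : ℝ) < s m := by exact_mod_cast Nat.pos_of_ne_zero hm
    have : q ^ (m + 1) < b ^ (m + 1) := pow_lt_pow_left₀ hb (by linarith) (by omega)
    gcongr

/-- Greedy orbit. -/
noncomputable def expOrb (b x : ℝ) : ℕ → ℝ
  | 0 => x
  | n + 1 => if 1 ≤ b * expOrb b x n then b * expOrb b x n - 1 else b * expOrb b x n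

/-- Greedy digits. -/
noncomputable def expDig (b x : ℝ) (n : ℕ) : ℕ := if 1 ≤ b * expOrb b x n then 1 else 0

lemma expVal_exists (b x : ℝ) (hb : 1 < b) (hb2 : b ≤ 2) (hx : 0 ≤ x) (hx2 : x ≤ 1 / (b - 1)) :
    ∃ s : ℕ → ℕ, (∀ i, s i ≤ 1) ∧ expVal b s = x := by
  have hb1 : 0 < b - 1 := by linarith
  have hr : ∀ n, 0 ≤ expOrb b x n ∧ expOrb b x n ≤ 1 / (b - 1) := by
    intro n
    induction n with
    | zero => exact ⟨hx, hx2⟩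
    | succ n ih =>
      obtain ⟨h1, h2⟩ := ih
      rw [le_div_iff₀ hb1] at h2
      simp only [expOrb]
      rw [le_div_iff₀ hb1]
      split_ifs with h
      · exact ⟨by linarith, by nlinarith⟩
      · push Not at h
        exact ⟨by positivity, by nlinarith⟩
  have hd : ∀ i, expDig b x i ≤ 1 := by intro i; unfold expDig; split_ifs <;> omega
  have hstep : ∀ n, b * expOrb b x n = expDig b x n + expOrb b x (n + 1) := by
    intro n
    simp only [expOrb, expDig]
    split_ifs <;> simp
  have hpart : ∀ n, x = ∑ i ∈ Finset.range n, (expDig b x i : ℝ) / b ^ (i + 1)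
      + expOrb b x n / b ^ n := by
    intro n
    induction n with
    | zero => simp [expOrb]
    | succ n ih =>
      rw [Finset.sum_range_succ, add_assoc, ← add_div, ← hstep, pow_succ']
      rw [mul_div_mul_left _ _ (by positivity)]
      exact ih
  refine ⟨expDig b x, hd, ?_⟩
  have ht := (expVal_summable b hb _ hd).hasSum.tendsto_sum_nat
  have hz : Filter.Tendsto (fun n => expOrb b x n / b ^ n) Filter.atTop (nhds 0) := by
    have hg := (tendsto_pow_atTop_nhds_zero_of_lt_one (r := b⁻¹) (by positivity)
      (inv_lt_one_of_one_lt₀ hb)).const_mul (1 / (b - 1))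
    rw [mul_zero] at hg
    refine squeeze_zero (fun n => div_nonneg (hr n).1 (by positivity)) (fun n => ?_) hg
    rw [div_eq_mul_inv, inv_pow]
    exact mul_le_mul_of_nonneg_right (hr n).2 (by positivity)
  have hs := ht.add hz
  rw [add_zero] at hs
  refine tendsto_nhds_unique hs ?_
  refine tendsto_const_nhds.congr hpart

/-- Prepend a digit. -/
def consDig (d : ℕ) (s : ℕ → ℕ) : ℕ → ℕ
  | 0 => d
  | k + 1 => s k

lemma consDig_le (d : ℕ) (s : ℕ → ℕ) (hd : d ≤ 1) (hs : ∀ i, s i ≤ 1) : ∀ i, consDig d s i ≤ 1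
  | 0 => hd
  | k + 1 => hs k

lemma consDig_val (b : ℝ) (hb : 1 < b) (d : ℕ) (s : ℕ → ℕ) (hd : d ≤ 1) (hs : ∀ i, s i ≤ 1) :
    b * expVal b (consDig d s) = d + expVal b s :=
  expVal_split b hb _ (consDig_le d s hd hs)

lemma univ_shift (b : ℝ) (hb : 1 < b) (s : ℕ → ℕ) (h : isUnivoqueSeq b s) :
    isUnivoqueSeq b (fun i => s (i + 1)) := by
  refine ⟨fun i => h.1 _, fun δ hδ he => ?_⟩
  have h0 : b ≠ 0 := by positivity
  have e : expVal b (consDig (s 0) δ) = expVal b s := by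
    apply mul_left_cancel₀ h0
    rw [consDig_val b hb _ _ (h.1 0) hδ, expVal_split b hb s h.1]
    congr 1
  have := h.2 _ (consDig_le _ _ (h.1 0) hδ) e
  funext i
  exact congrFun this (i + 1)

lemma univ_shift_n (b : ℝ) (hb : 1 < b) (s : ℕ → ℕ) (h : isUnivoqueSeq b s) (n : ℕ) :
    isUnivoqueSeq b (fun i => s (n + i)) := by
  induction n with
  | zero => simpa using h
  | succ n ih =>
    have := univ_shift b hb _ ih
    convert this using 3
    omega

lemma univ_zero (b : ℝ) (hb : 1 < b) (hb2 : b ≤ 2) (s : ℕ → ℕ) (h : isUnivoqueSeq b s)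
    (h0 : s 0 = 0) : expVal b (fun i => s (i + 1)) < 1 := by
  by_contra hc
  push Not at hc
  have hn := expVal_nonneg b hb (fun i => 1 - s (i + 1))
  have hcj := expVal_conj b hb (fun i => s (i + 1)) (fun i => h.1 _)
  obtain ⟨t, ht, hv⟩ := expVal_exists b (expVal b (fun i => s (i + 1)) - 1) hb hb2
    (by linarith) (by linarith)
  have e : expVal b (consDig 1 t) = expVal b s := by
    apply mul_left_cancel₀ (show b ≠ 0 by positivity)
    rw [consDig_val b hb _ _ le_rfl ht, expVal_split b hb s h.1, h0, hv]
    push_cast; ring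
  have := congrFun (h.2 _ (consDig_le _ _ le_rfl ht) e) 0
  simp [consDig, h0] at this

lemma univ_one (b : ℝ) (hb : 1 < b) (hb2 : b ≤ 2) (s : ℕ → ℕ) (h : isUnivoqueSeq b s)
    (h0 : s 0 = 1) : expVal b (fun i => 1 - s (i + 1)) < 1 := by
  by_contra hc
  push Not at hc
  have hn := expVal_nonneg b hb (fun i => s (i + 1))
  have hcj := expVal_conj b hb (fun i => s (i + 1)) (fun i => h.1 _)
  obtain ⟨t, ht, hv⟩ := expVal_exists b (expVal b (fun i => s (i + 1)) + 1) hb hb2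
    (by linarith) (by linarith)
  have e : expVal b (consDig 0 t) = expVal b s := by
    apply mul_left_cancel₀ (show b ≠ 0 by positivity)
    rw [consDig_val b hb _ _ (by omega) ht, expVal_split b hb s h.1, h0, hv]
    push_cast; ring
  have := congrFun (h.2 _ (consDig_le _ _ (by omega) ht) e) 0
  simp [consDig, h0] at this

lemma univ_of (b : ℝ) (hb : 1 < b) (s : ℕ → ℕ) (hs : ∀ i, s i ≤ 1)
    (h0 : ∀ n, s n = 0 → expVal b (fun i => s (n + 1 + i)) < 1)
    (h1 : ∀ n, s n = 1 → expVal b (fun i => 1 - s (n + 1 + i)) < 1) : isUnivoqueSeq b s := by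
  refine ⟨hs, fun δ hδ he => ?_⟩
  have key : ∀ n, expVal b (fun i => δ (n + i)) = expVal b (fun i => s (n + i)) →
      δ n = s n ∧ expVal b (fun i => δ (n + 1 + i)) = expVal b (fun i => s (n + 1 + i)) := by
    intro n hn
    have e1 := expVal_split b hb (fun i => δ (n + i)) (fun i => hδ _)
    have e2 := expVal_split b hb (fun i => s (n + i)) (fun i => hs _)
    have r : ∀ u : ℕ → ℕ, (fun i => u (n + (i + 1))) = fun i => u (n + 1 + i) := by
      intro u; funext i; congr 1; omega
    simp only [add_zero, r] at e1 e2
    rw [hn, e2] at e1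
    have c1 := expVal_conj b hb (fun i => δ (n + 1 + i)) (fun i => hδ _)
    have c2 := expVal_conj b hb (fun i => s (n + 1 + i)) (fun i => hs _)
    have p1 := expVal_nonneg b hb (fun i => δ (n + 1 + i))
    have p2 := expVal_nonneg b hb (fun i => 1 - δ (n + 1 + i))
    have g0 := h0 n
    have g1 := h1 n
    rcases Nat.le_one_iff_eq_zero_or_eq_one.mp (hδ n) with hd | hd <;>
    rcases Nat.le_one_iff_eq_zero_or_eq_one.mp (hs n) with hd' | hd' <;>
    rw [hd, hd'] at e1 <;> push_cast at e1
    · exact ⟨by omega, by linarith⟩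
    · have := g1 hd'; linarith
    · have := g0 hd'; linarith
    · exact ⟨by omega, by linarith⟩
  have all : ∀ n, expVal b (fun i => δ (n + i)) = expVal b (fun i => s (n + i)) := by
    intro n
    induction n with
    | zero => simpa [expVal] using he
    | succ n ih => exact (key n ih).2
  funext n
  exact (key n (all n)).1

theorem zero_alpha_q_univoque
    (β : ℝ) (hβ : β ∈ Set.Ioc (1 : ℝ) 2)
    (q : ℝ) (hq : q ∈ Set.Ico ((1 + Real.sqrt 5) / 2) β)
    (γ : ℕ → ℕ) (hγ : isQuasiGreedy q γ)
    -- 1 has a unique q-expansion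
    (huniq : ∀ δ δ' : ℕ → ℕ, isExpansion q 1 δ → isExpansion q 1 δ' → δ = δ') :
    isUnivoqueSeq β (prepend0 γ) ∧
      ∃! ε : ℕ → ℕ,
        isExpansion β (∑' i : ℕ, (prepend0 γ i : ℝ) / β ^ (i + 1)) ε := by
  obtain ⟨hb1, hb2⟩ := hβ
  obtain ⟨hq1, hq2⟩ := hq
  obtain ⟨hd, hz, hv, -⟩ := hγ
  have hq0 : 1 < q := by
    have : (1 : ℝ) < Real.sqrt 5 := by
      rw [Real.lt_sqrt] <;> norm_num
    linarith
  have hu : isUnivoqueSeq q γ :=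
    ⟨hd, fun δ hδ he => huniq δ γ ⟨hδ, by rw [he, hv]⟩ ⟨hd, hv.symm⟩⟩
  have r : ∀ n, (fun i => γ (n + (i + 1))) = fun i => prepend0 γ (n + 1 + 1 + i) := by
    intro n; funext i
    rw [show n + 1 + 1 + i = (n + (i + 1)) + 1 by omega]
    rfl
  have hp : ∀ i, prepend0 γ i ≤ 1 := fun i => by cases i with
    | zero => exact Nat.zero_le _
    | succ k => exact hd k
  have main : isUnivoqueSeq β (prepend0 γ) := by
    refine univ_of β hb1 _ hp ?_ ?_
    · intro n hn
      cases n with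
      | zero =>
        obtain ⟨m, -, hm⟩ := hz 0
        have h := expVal_strict q β hq0 hq2 γ hd m hm
        have e : (fun i => prepend0 γ (0 + 1 + i)) = γ := by
          funext i
          rw [show 0 + 1 + i = i + 1 by omega]
          rfl
        rw [e]
        exact h.trans_eq hv
      | succ n =>
        have h := univ_zero q hq0 (by linarith) _ (univ_shift_n q hq0 γ hu n) hn
        rw [r n] at h
        exact (expVal_mono q β hq0 hq2.le _ (fun i => hp _)).trans_lt h
    · intro n hn
      cases n with
      | zero => exact absurd hn (by simp [prepend0])
      | succ n =>
        have h := univ_one q hq0 (by linarith) _ (univ_shift_n q hq0 γ hu n) hn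
        have e : (fun i => 1 - γ (n + (i + 1))) = fun i => 1 - prepend0 γ (n + 1 + 1 + i) := by
          funext i
          rw [← congrFun (r n) i]
        rw [e] at h
        exact (expVal_mono q β hq0 hq2.le _ (fun i => Nat.sub_le _ _)).trans_lt h
  exact ⟨main, prepend0 γ, ⟨hp, rfl⟩, fun ε hε => main.2 ε hε.1 hε.2.symm⟩
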